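/- For every NPLCS N, location q and set of locations B ⊆ Q, the following are equivalent: (c.1) there exists a scheduler U with Pr_U((q,ε) ⊨ □B) > 0; (c.2) there exists an almost blind, memoryless scheduler U with Pr_U((q,ε) ⊨ □B) > 0; (c.3) (q,ε) →*_[B] Safe(B), i.e., some configuration with location in Safe(B) is reachable from (q,ε) by a path visiting only locations of B. -/

import Mathlib

open scoped ENNReal
open Classical

namespace NPLCSmodel

/-! ## Lossy channel systems -/

/-- Operations of a lossy channel system: send a message on a channel,
receive a message from a channel, or an internal action. -/
inductive LcsOp (C M : Type) : Type where
  | send : C → M → LcsOp C M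
  | recv : C → M → LcsOp C M
  | internal : LcsOp C M

def LcsOp.IsRecv {C M : Type} : LcsOp C M → Prop
  | .recv _ _ => True
  | _ => False

/-- A transition rule `src --op--> dst`. -/
structure LcsRule (Q C M : Type) : Type where
  src : Q
  op : LcsOp C M
  dst : Q

/-- Channel contents: a word over `M` for each channel. -/
abbrev Chans (C M : Type) : Type := C → List M

/-- Configurations: a location together with channel contents. -/
abbrev Conf (Q C M : Type) : Type := Q × Chans C M

/-- The empty channel contents ε. -/
def eps (C M : Type) : Chans C M := fun _ => []

variable {Q C M : Type}

/-- When is an operation possible on channel contents `w`? -/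
def enabledOp : LcsOp C M → Chans C M → Prop
  | .recv c m, w => ∃ v, w c = m :: v
  | .send _ _, _ => True
  | .internal, _ => True

/-- Effect of an operation on the channel contents (for a perfect step). -/
def applyOp [DecidableEq C] : LcsOp C M → Chans C M → Chans C M
  | .send c m, w => Function.update w c (w c ++ [m])
  | .recv c _, w => Function.update w c (w c).tail
  | .internal, w => w

/-- A rule is enabled in a configuration. -/
def LcsRule.EnabledIn (δ : LcsRule Q C M) (s : Conf Q C M) : Prop :=
  δ.src = s.1 ∧ enabledOp δ.op s.2

/-- A lossy channel system `L = (Q, C, M, Δ)` (the finiteness of the location,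
channel and message types is imposed by `Fintype` assumptions at use sites):
a finite set of transition rules such that every location has at least one
outgoing rule that is not a receive. -/
structure LCS (Q C M : Type) : Type where
  rules : Set (LcsRule Q C M)
  finiteRules : rules.Finite
  noDeadlock : ∀ q : Q, ∃ δ ∈ rules, δ.src = q ∧ ¬ δ.op.IsRecv

variable [DecidableEq C]

/-- Lossy step via rule `δ`: a perfect step followed by losing arbitrarily
many messages (`<+` is the (componentwise) subword relation). -/
def LCS.StepVia (L : LCS Q C M) (s : Conf Q C M) (δ : LcsRule Q C M)
    (t : Conf Q C M) : Prop :=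
  δ ∈ L.rules ∧ δ.EnabledIn s ∧ t.1 = δ.dst ∧ ∀ c, List.Sublist (t.2 c) (applyOp δ.op s.2 c)

/-- Lossy step `s → t`. -/
def LCS.Step (L : LCS Q C M) (s t : Conf Q C M) : Prop := ∃ δ, L.StepVia s δ t

/-- Reachability `s →* t`. -/
def LCS.Reach (L : LCS Q C M) : Conf Q C M → Conf Q C M → Prop :=
  Relation.ReflTransGen L.Step

/-- Constrained reachability `s →*_[X) t`: all configurations along the path,
except possibly the last one, have their location in `X`. -/
def LCS.ReachWithin (L : LCS Q C M) (X : Set Q) : Conf Q C M → Conf Q C M → Prop :=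
  Relation.ReflTransGen (fun a b => L.Step a b ∧ a.1 ∈ X)

/-- Constrained reachability `s →*_[X] t`: all configurations along the path,
including `s` and `t`, have their location in `X`. -/
def LCS.ReachConstrained (L : LCS Q C M) (X : Set Q) (s t : Conf Q C M) : Prop :=
  L.ReachWithin X s t ∧ t.1 ∈ X

/-- `X` is safe for `A`. -/
def LCS.IsSafeFor (L : LCS Q C M) (A X : Set Q) : Prop :=
  X ⊆ A ∧ ∀ x ∈ X, ∃ t, L.Step (x, eps C M) t ∧ t.1 ∈ X

/-- `Safe(A)`: the largest set safe for `A` (the union of all such sets). -/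
def LCS.Safe (L : LCS Q C M) (A : Set Q) : Set Q := ⋃₀ {X | L.IsSafeFor A X}

/-- `X` is promising for `A`. -/
def LCS.IsPromisingFor (L : LCS Q C M) (A X : Set Q) : Prop :=
  ∀ x ∈ X, ∃ t, L.ReachWithin X (x, eps C M) t ∧ t.1 ∈ A

/-- `Prom(A)`: the largest set promising for `A` (the union of all such sets). -/
def LCS.Prom (L : LCS Q C M) (A : Set Q) : Set Q := ⋃₀ {X | L.IsPromisingFor A X}

/-! ## NPLCS and the induced Markov decision process -/

/-- An NPLCS: an LCS together with a fault rate `τ ∈ (0,1)`. -/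
structure NPLCS (Q C M : Type) : Type where
  L : LCS Q C M
  τ : ℝ
  τ_pos : 0 < τ
  τ_lt_one : τ < 1

/-- The number of embeddings of the second list as a subword of the first. -/
def countEmb [DecidableEq M] : List M → List M → ℕ
  | _, [] => 1
  | [], _ :: _ => 0
  | a :: v, b :: w => (if a = b then countEmb v w else 0) + countEmb v (b :: w)

variable [Fintype C] [DecidableEq M]

/-- Total number of messages in the channels. -/
def chansSize (w : Chans C M) : ℕ := ∑ c, (w c).length

/-- `P_lost(v,v') = τ^(|v|-|v'|) · (1-τ)^|v'| · C(v,v')`, the probability that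
channel contents `v` become `v'` through message losses. -/
noncomputable def plost (τ : ℝ) (v v' : Chans C M) : ℝ≥0∞ :=
  ENNReal.ofReal
    (τ ^ (chansSize v - chansSize v') * (1 - τ) ^ chansSize v' *
      (∏ c, countEmb (v c) (v' c) : ℕ))

/-- One-step probability `P_N(s, δ, t)` of the MDP of an NPLCS. -/
noncomputable def NPLCS.stepProb (N : NPLCS Q C M) (s : Conf Q C M)
    (δ : LcsRule Q C M) (t : Conf Q C M) : ℝ≥0∞ :=
  if δ ∈ N.L.rules ∧ δ.EnabledIn s ∧ t.1 = δ.dst then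
    plost N.τ (applyOp δ.op s.2) t.2
  else 0

/-! ## Probability measure of a countable-state Markov chain

Given one-step probabilities `k` on a state space `S`, the measure of a set of
trajectories is the Carathéodory outer measure generated by the probabilities
of cylinder sets; it agrees with the usual Markov-chain measure on all
measurable (in particular, on all ω-regular) sets of trajectories. -/

section Chain
variable {S : Type}

/-- Probability that the chain starting in `s` performs the finite sequence
of steps through the configurations listed in `l`. -/
noncomputable def chainPathProb (k : S → S → ℝ≥0∞) : S → List S → ℝ≥0∞
  | _, [] => 1
  | s, t :: l => k s t * chainPathProb k t l

/-- The cylinder of trajectories starting with `s` followed by `l`. -/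
def chainCyl (s : S) (l : List S) : Set (ℕ → S) :=
  {ω | ω 0 = s ∧ ∀ (i : ℕ) (h : i < l.length), ω (i + 1) = l.get ⟨i, h⟩}

/-- Premeasure: probability of a cylinder set, `∞` on other (nonempty) sets. -/
noncomputable def chainFun (k : S → S → ℝ≥0∞) (s : S) (A : Set (ℕ → S)) : ℝ≥0∞ :=
  if A = ∅ then 0 else ⨅ (l : List S) (_ : A = chainCyl s l), chainPathProb k s l

theorem chainFun_empty (k : S → S → ℝ≥0∞) (s : S) : chainFun k s ∅ = 0 := by
  simp [chainFun]

/-- The probability, for the Markov chain with one-step probabilities `k`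
started in `s`, of the set `E` of trajectories (paths starting in `s`). -/
noncomputable def chainPr (k : S → S → ℝ≥0∞) (s : S) (E : Set (ℕ → S)) : ℝ≥0∞ :=
  MeasureTheory.OuterMeasure.ofFunction (chainFun k s) (chainFun_empty k s)
    (E ∩ {ω | ω 0 = s})

end Chain

/-! ## Schedulers -/

/-- A (history-dependent, deterministic) scheduler: given the history
`h = s₁ → ⋯ → s_{n-1}` and the current configuration `sₙ`, it chooses a
transition rule of `N` enabled in `sₙ`. -/
structure Scheduler (N : NPLCS Q C M) : Type where
  choose : List (Conf Q C M) → Conf Q C M → LcsRule Q C M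
  choose_mem : ∀ h s, choose h s ∈ N.L.rules
  choose_enabled : ∀ h s, (choose h s).EnabledIn s

variable {N : NPLCS Q C M}

/-- The Markov chain `MC_U` induced by a scheduler: its states are finite
paths, represented as (history, current configuration). -/
noncomputable def Scheduler.kernel (U : Scheduler N) :
    List (Conf Q C M) × Conf Q C M → List (Conf Q C M) × Conf Q C M → ℝ≥0∞ :=
  fun a b =>
    if b.1 = a.1 ++ [a.2] then N.stepProb a.2 (U.choose a.1 a.2) b.2 else 0

/-- `Pr_U(s ⊨ E)`: the probability, under scheduler `U` with starting
configuration `s`, of the set `E` of infinite paths (trajectories of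
configurations). -/
noncomputable def Scheduler.Pr (U : Scheduler N) (s : Conf Q C M)
    (E : Set (ℕ → Conf Q C M)) : ℝ≥0∞ :=
  chainPr U.kernel ([], s) {ω | (fun i => (ω i).2) ∈ E}

/-- Memoryless scheduler: the decision depends only on the current
configuration. -/
def Scheduler.Memoryless (U : Scheduler N) : Prop :=
  ∀ h h' s, U.choose h s = U.choose h' s

/-- Blind scheduler: the decision depends only on the sequence of locations
that have been visited. -/
def Scheduler.Blind (U : Scheduler N) : Prop :=
  ∀ h h' s s', h.map Prod.fst = h'.map Prod.fst → s.1 = s'.1 →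
    U.choose h s = U.choose h' s'

/-- Finite-memory scheduler data: finitely many modes, a starting mode, a
decision rule and a next-mode function. -/
structure FMScheduler (N : NPLCS Q C M) : Type 1 where
  Mode : Type
  modeFin : Fintype Mode
  init : Mode
  D : Mode → Conf Q C M → LcsRule Q C M
  upd : Mode → Conf Q C M → Mode
  D_mem : ∀ u s, D u s ∈ N.L.rules
  D_enabled : ∀ u s, (D u s).EnabledIn s

/-- A scheduler is finite-memory if it is induced by finite-memory data. -/
def Scheduler.FiniteMemory (U : Scheduler N) : Prop :=
  ∃ fm : FMScheduler N, ∀ h s, U.choose h s = fm.D (h.foldl fm.upd fm.init) s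

/-- The Markov chain `MC_U` of a finite-memory scheduler: states are pairs
`s_u` of a configuration `s` and a mode `u`. -/
noncomputable def FMScheduler.kernel (fm : FMScheduler N) :
    Conf Q C M × fm.Mode → Conf Q C M × fm.Mode → ℝ≥0∞ :=
  fun a b =>
    if b.2 = fm.upd a.2 a.1 then N.stepProb a.1 (fm.D a.2 a.1) b.1 else 0

/-- Probability measure of the Markov chain `MC_U` of a finite-memory
scheduler, over trajectories of (configuration, mode) states. -/
noncomputable def FMScheduler.PrMC (fm : FMScheduler N)
    (a : Conf Q C M × fm.Mode) (E : Set (ℕ → Conf Q C M × fm.Mode)) : ℝ≥0∞ :=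
  chainPr fm.kernel a E

/-- Reachability in the Markov chain `MC_U` of a finite-memory scheduler. -/
def FMScheduler.MCReach (fm : FMScheduler N) :
    Conf Q C M × fm.Mode → Conf Q C M × fm.Mode → Prop :=
  Relation.ReflTransGen (fun a b => 0 < fm.kernel a b)

/-- The history (the first `i` configurations) of a trajectory. -/
def histTo (ω : ℕ → Conf Q C M) (i : ℕ) : List (Conf Q C M) :=
  (List.range i).map ω

/-- Almost blind scheduler: there are a scheduler `W` and a blind scheduler
`V` such that from any starting configuration, almost surely the choices of
`U` along the path agree with those of `W` up to some finite time and with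
those of `V` afterwards. -/
def Scheduler.AlmostBlind (U : Scheduler N) : Prop :=
  ∃ W V : Scheduler N, V.Blind ∧ ∀ s : Conf Q C M,
    U.Pr s {ω | ∃ n : ℕ,
      (∀ i ≤ n, U.choose (histTo ω i) (ω i) = W.choose (histTo ω i) (ω i)) ∧
      (∀ i, n < i → U.choose (histTo ω i) (ω i) = V.choose (histTo ω i) (ω i))} = 1

/-! ## LTL-style events on trajectories -/

/-- `□P` -/
def evAlways {α : Type} (P : α → Prop) : Set (ℕ → α) := {ω | ∀ i, P (ω i)}

/-- `◇P` -/
def evEventually {α : Type} (P : α → Prop) : Set (ℕ → α) := {ω | ∃ i, P (ω i)}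

/-- `□◇P` -/
def evInfOften {α : Type} (P : α → Prop) : Set (ℕ → α) :=
  {ω | ∀ n, ∃ i, n ≤ i ∧ P (ω i)}

/-- `◇□P` -/
def evEvAlways {α : Type} (P : α → Prop) : Set (ℕ → α) :=
  {ω | ∃ n, ∀ i, n ≤ i → P (ω i)}

/-- The atomic proposition "the current location belongs to `A`". -/
def inLoc (A : Set Q) : Conf Q C M → Prop := fun s => s.1 ∈ A

set_option linter.unusedSectionVars false

section ChainLemmas

open MeasureTheory ProbabilityTheory

variable {S : Type}


theorem chainPathProb_append_singleton (k : S → S → ℝ≥0∞) (s : S) (l : List S) (t : S) :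
    chainPathProb k s (l ++ [t]) =
      chainPathProb k s l * k ((s :: l).getLast (List.cons_ne_nil _ _)) t := by
  induction l generalizing s with
  | nil => simp [chainPathProb]
  | cons a l ih => simp [chainPathProb, ih, mul_assoc]

/-- A stochastic kernel on a countable state space induces a probability measure on trajectories
giving every cylinder its path probability. -/
theorem exists_trajectory_measure [Countable S] [MeasurableSpace S] [DiscreteMeasurableSpace S]
    (k : S → S → ℝ≥0∞) (hk : ∀ a, ∑' b, k a b = 1) (s : S) :
    ∃ P : Measure (ℕ → S), IsProbabilityMeasure P ∧
      ∀ l, P (chainCyl s l) = chainPathProb k s l := by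
  let pm : S → PMF S := fun a => ⟨k a, by
    rw [ENNReal.summable.hasSum_iff]; exact hk a⟩
  let κ₀ : Kernel S S := ⟨fun a => (pm a).toMeasure, measurable_of_countable _⟩
  have hκ₀ : IsMarkovKernel κ₀ := ⟨fun a => by
    change IsProbabilityMeasure (pm a).toMeasure; infer_instance⟩
  let κ : (n : ℕ) → Kernel (Π _ : Finset.Iic n, S) S := fun n =>
    κ₀.comap (fun x => x ⟨n, Finset.mem_Iic.2 le_rfl⟩) (measurable_pi_apply _)
  have hκ : ∀ n, IsMarkovKernel (κ n) := fun n => by dsimp only [κ]; infer_instance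
  let x₀ : Π _ : Finset.Iic 0, S := fun _ => s
  let P : Measure (ℕ → S) := Kernel.traj (X := fun _ => S) κ 0 x₀
  refine ⟨P, by dsimp only [P]; infer_instance, fun l => ?_⟩
  induction l using List.reverseRecOn with
  | nil =>
    have h1 : chainCyl s [] = Preorder.frestrictLe (π := fun _ : ℕ => S) 0 ⁻¹' {x₀} := by
      ext ω
      simp only [chainCyl, List.length_nil, Set.mem_ofPred_eq, Set.mem_preimage,
        Set.mem_singleton_iff]
      constructor
      · rintro ⟨h, -⟩
        funext ⟨i, hi⟩
        have : i = 0 := by simpa using hi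
        subst this
        simpa [x₀] using h
      · intro h
        refine ⟨?_, fun i hi => absurd hi (by simp)⟩
        exact congrFun h ⟨0, by simp⟩
    have h2 : MeasurableSet ({x₀} : Set (Π _ : Finset.Iic 0, S)) := measurableSet_singleton _
    rw [h1, ← Measure.map_apply (by fun_prop) h2]
    simp only [P]
    rw [Kernel.traj_map_frestrictLe_apply, Kernel.partialTraj_self, Kernel.id_apply,
      Measure.dirac_apply_of_mem (Set.mem_singleton x₀), chainPathProb]
  | append_singleton l t ih =>
    set n := l.length with hn
    let A : Set (Π _ : Finset.Iic n, S) :=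
      {x | x ⟨0, by simp⟩ = s ∧ ∀ (i : ℕ) (h : i < l.length),
        x ⟨i + 1, by simp; omega⟩ = l.get ⟨i, h⟩}
    have hA : MeasurableSet A := (Set.to_countable A).measurableSet
    have h1 : chainCyl s l = Preorder.frestrictLe (π := fun _ : ℕ => S) n ⁻¹' A := rfl
    have h2 : chainCyl s (l ++ [t]) =
        (fun x : ℕ → S => (Preorder.frestrictLe (π := fun _ : ℕ => S) n x, x (n + 1))) ⁻¹'
          (A ×ˢ {t}) := by
      rw [Set.mk_preimage_prod, ← h1]
      ext ω
      simp only [chainCyl, Set.mem_ofPred_eq, Set.mem_inter_iff, Set.mem_preimage,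
        Set.mem_singleton_iff]
      constructor
      · rintro ⟨h, h'⟩
        refine ⟨⟨h, fun i hi => ?_⟩, ?_⟩
        · have := h' i (by simp; omega)
          simpa [List.getElem_append, hi] using this
        · have := h' n (by simp [hn])
          simpa [hn] using this
      · rintro ⟨⟨h, h'⟩, h''⟩
        refine ⟨h, fun i hi => ?_⟩
        by_cases hil : i < l.length
        · simpa [List.getElem_append, hil] using h' i hil
        · have : i = n := by simp at hi; omega
          subst this
          simpa [hn] using h''
    have hcp := Kernel.partialTraj_compProd_eq_map_traj (X := fun _ => S) (κ := κ)
      (Nat.zero_le n) (x₀ := x₀)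
    have hAt : MeasurableSet (A ×ˢ ({t} : Set S)) := hA.prod (measurableSet_singleton t)
    have hlast : ∀ x ∈ A, κ n x {t} = k ((s :: l).getLast (List.cons_ne_nil _ _)) t := by
      intro x hx
      have e : x ⟨n, Finset.mem_Iic.2 le_rfl⟩ = (s :: l).getLast (List.cons_ne_nil _ _) := by
        obtain ⟨hx0, hx1⟩ := hx
        rw [List.getLast_eq_getElem]
        rcases Nat.eq_zero_or_pos n with h0 | h0
        · have hl : l = [] := List.length_eq_zero_iff.1 h0
          subst hl
          exact hx0
        · have := hx1 (n - 1) (by omega)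
          have e2 : (⟨n - 1 + 1, by simp; omega⟩ : Finset.Iic n) =
              ⟨n, Finset.mem_Iic.2 le_rfl⟩ := by
            ext; simp; omega
          rw [e2] at this
          rw [this]
          simp only [List.get_eq_getElem, List.length_cons, Nat.add_sub_cancel]
          rw [List.getElem_cons, dif_neg (by omega)]
      have : κ n x {t} = (pm (x ⟨n, Finset.mem_Iic.2 le_rfl⟩)).toMeasure {t} := rfl
      rw [this, PMF.toMeasure_apply_singleton _ _ (measurableSet_singleton t), e]
      rfl
    rw [h2, ← Measure.map_apply (by fun_prop) hAt]
    simp only [P]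
    rw [← hcp, Measure.compProd_apply_prod hA (measurableSet_singleton t),
      setLIntegral_congr_fun hA hlast, setLIntegral_const, chainPathProb_append_singleton, ← ih,
      h1, ← Measure.map_apply (by fun_prop) hA, mul_comm]
    simp only [P]
    rw [Kernel.traj_map_frestrictLe_apply]

/-- The probability that the first `n` steps of the chain from `s` satisfy `A`. -/
noncomputable def pathSum (k : S → S → ℝ≥0∞) : ℕ → S → (List S → Prop) → ℝ≥0∞
  | 0, _, A => if A [] then 1 else 0
  | n + 1, s, A => ∑' b, k s b * pathSum k n b (fun l => A (b :: l))

theorem tsum_chainPathProb (k : S → S → ℝ≥0∞) (n : ℕ) (s : S) (A : List S → Prop) :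
    ∑' l : List S, (if l.length = n ∧ A l then chainPathProb k s l else 0) =
      pathSum k n s A := by
  induction n generalizing s A with
  | zero =>
    rw [tsum_eq_single []]
    · simp [pathSum, chainPathProb]
    · intro l hl
      simp [hl]
  | succ n ih =>
    have hinj : Function.Injective (fun p : S × List S => p.1 :: p.2) := by
      rintro ⟨a, l⟩ ⟨b, l'⟩ h
      simpa using h
    rw [← hinj.tsum_eq, ENNReal.tsum_prod']
    · simp only [pathSum, ← ih, List.length_cons, Nat.add_right_cancel_iff, chainPathProb]
      refine tsum_congr fun b => ?_
      rw [← ENNReal.tsum_mul_left]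
      refine tsum_congr fun l => ?_
      split_ifs <;> simp
    · intro l hl
      cases l with
      | nil => simp at hl
      | cons a l => exact ⟨(a, l), rfl⟩

theorem pathSum_add_pathSum_not (k : S → S → ℝ≥0∞) (hk : ∀ a, ∑' b, k a b = 1) (n : ℕ) (s : S)
    (A : List S → Prop) : pathSum k n s A + pathSum k n s (fun l => ¬ A l) = 1 := by
  induction n generalizing s A with
  | zero => by_cases h : A [] <;> simp [pathSum, h]
  | succ n ih =>
    simp only [pathSum]
    rw [← ENNReal.tsum_add]
    simp only [← mul_add, ih, mul_one, hk]

/-- The first `n` states visited after the initial one. -/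
def prefixList (n : ℕ) (ω : ℕ → S) : List S := List.ofFn (fun i : Fin n => ω (i + 1))

theorem chainPr_le_of_subset (k : S → S → ℝ≥0∞) (s : S) {E F : Set (ℕ → S)} (h : E ⊆ F) :
    chainPr k s E ≤ chainPr k s F :=
  measure_mono (Set.inter_subset_inter_left _ h)

theorem chainPr_prefix_le [Countable S] (k : S → S → ℝ≥0∞) (n : ℕ) (s : S) (A : List S → Prop) :
    chainPr k s {ω | A (prefixList n ω)} ≤ pathSum k n s A := by
  have hsub : {ω | A (prefixList n ω)} ∩ {ω | ω 0 = s} ⊆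
      ⋃ l : List S, (if l.length = n ∧ A l then chainCyl s l else ∅) := by
    rintro ω ⟨h, h0⟩
    refine Set.mem_iUnion.2 ⟨prefixList n ω, ?_⟩
    have : (prefixList n ω).length = n ∧ A (prefixList n ω) := ⟨by simp [prefixList], h⟩
    rw [if_pos this]
    exact ⟨h0, fun i hi => by simp [prefixList]⟩
  refine (measure_mono hsub).trans ((measure_iUnion_le _).trans ?_)
  rw [← tsum_chainPathProb]
  refine ENNReal.tsum_le_tsum fun l => ?_
  split_ifs
  · refine (OuterMeasure.ofFunction_le _).trans ?_
    unfold chainFun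
    split_ifs
    · exact zero_le
    · exact iInf₂_le (f := fun l' (_ : chainCyl s l = chainCyl s l') => chainPathProb k s l') l rfl
  · simp

theorem exists_measure_le_chainPr [Countable S] (k : S → S → ℝ≥0∞) (hk : ∀ a, ∑' b, k a b = 1)
    (s : S) : ∃ μ : OuterMeasure (ℕ → S), μ Set.univ = 1 ∧
      (∀ E : ℕ → Set (ℕ → S), Monotone E → μ (⋃ n, E n) = ⨆ n, μ (E n)) ∧
      ∀ E, μ E ≤ chainPr k s E := by
  let _ : MeasurableSpace S := ⊤
  obtain ⟨P, hP, hcyl⟩ := exists_trajectory_measure k hk s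
  refine ⟨P.toOuterMeasure, measure_univ (μ := P), fun E hE => hE.measure_iUnion (μ := P),
    fun E => ?_⟩
  have h0 : P {ω | ω 0 = s} = 1 := by
    have := hcyl []
    simpa [chainCyl, chainPathProb] using this
  have h0' : P {ω | ω 0 = s}ᶜ = 0 := by
    have hm : MeasurableSet {ω : ℕ → S | ω 0 = s} :=
      measurableSet_eq_fun (measurable_pi_apply 0) measurable_const
    rwa [prob_compl_eq_zero_iff hm]
  have hle : P.toOuterMeasure ≤ OuterMeasure.ofFunction (chainFun k s) (chainFun_empty k s) := by
    rw [OuterMeasure.le_ofFunction]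
    intro A
    unfold chainFun
    split_ifs with hA
    · simp [hA]
    · refine le_iInf₂ fun l hl => ?_
      rw [hl]
      exact (hcyl l).le
  have h1 : P E ≤ P (E ∩ {ω | ω 0 = s}) := by
    calc P E ≤ P (E ∩ {ω | ω 0 = s} ∪ {ω | ω 0 = s}ᶜ) := by
          refine measure_mono fun ω hω => ?_
          by_cases h : ω 0 = s
          · exact Or.inl ⟨hω, h⟩
          · exact Or.inr h
      _ ≤ _ := measure_union_le _ _
      _ = _ := by rw [h0', add_zero]
  exact h1.trans (hle _)

theorem chainPr_le_one [Countable S] (k : S → S → ℝ≥0∞) (s : S) (E : Set (ℕ → S)) :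
    chainPr k s E ≤ 1 := by
  have := chainPr_prefix_le k 0 s (fun _ => True)
  simp only [pathSum, if_true] at this
  exact (chainPr_le_of_subset k s (fun _ _ => trivial)).trans this

/-- A uniform lower bound on staying `n` steps in `G` is a lower bound on staying forever. -/
theorem le_chainPr_always [Countable S] (k : S → S → ℝ≥0∞) (hk : ∀ a, ∑' b, k a b = 1) (s : S)
    (G : Set S) (hs : s ∈ G) (c : ℝ≥0∞) (hc : ∀ n, c ≤ pathSum k n s (fun l => ∀ x ∈ l, x ∈ G)) :
    c ≤ chainPr k s {ω | ∀ i, ω i ∈ G} := by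
  obtain ⟨μ, hμ1, hμc, hμ⟩ := exists_measure_le_chainPr k hk s
  have hc1 : c ≤ 1 := (hc 0).trans (by simp [pathSum])
  let E : ℕ → Set (ℕ → S) := fun n => {ω | ¬ ∀ x ∈ prefixList n ω, x ∈ G}
  have hE : Monotone E := by
    intro m n hmn ω hω h
    refine hω fun x hx => ?_
    simp only [prefixList, List.mem_ofFn] at hx
    obtain ⟨i, rfl⟩ := hx
    exact h _ (by simp only [prefixList, List.mem_ofFn]; exact ⟨⟨i, i.2.trans_le hmn⟩, rfl⟩)
  have hEn : ∀ n, μ (E n) ≤ 1 - c := by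
    intro n
    refine (hμ _).trans ((chainPr_prefix_le k n s (fun l => ¬ ∀ x ∈ l, x ∈ G)).trans ?_)
    refine ENNReal.le_sub_of_add_le_left (ne_top_of_le_ne_top ENNReal.one_ne_top hc1) ?_
    rw [← pathSum_add_pathSum_not k hk n s (fun l => ∀ x ∈ l, x ∈ G)]
    gcongr
    exact hc n
  have hU : μ (⋃ n, E n) ≤ 1 - c := by
    rw [hμc E hE]
    exact iSup_le hEn
  have h0 : μ {ω | ω 0 ≠ s} ≤ 0 := by
    refine (hμ _).trans ?_
    have : {ω : ℕ → S | ω 0 ≠ s} ∩ {ω | ω 0 = s} = ∅ := by ext; simp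
    simp [chainPr, this]
  have hcov : (Set.univ : Set (ℕ → S)) ⊆ {ω | ∀ i, ω i ∈ G} ∪ ((⋃ n, E n) ∪ {ω | ω 0 ≠ s}) := by
    intro ω _
    by_contra hcon
    simp only [Set.mem_union, not_or, Set.mem_iUnion, not_exists, Set.mem_ofPred_eq, E,
      not_not] at hcon
    obtain ⟨h1, h2, h3⟩ := hcon
    refine h1 fun i => ?_
    cases i with
    | zero => rwa [h3]
    | succ i =>
      exact h2 (i + 1) _ (by
        simp only [prefixList, List.mem_ofFn]; exact ⟨⟨i, i.lt_succ_self⟩, rfl⟩)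
  have htot : (1 : ℝ≥0∞) ≤ μ {ω | ∀ i, ω i ∈ G} + (1 - c) := by
    rw [← hμ1]
    refine (measure_mono hcov).trans ((measure_union_le _ _).trans ?_)
    rw [hμ1]
    gcongr
    refine (measure_union_le _ _).trans ?_
    calc _ ≤ (1 - c) + 0 := add_le_add hU h0
      _ = _ := add_zero _
  refine le_trans ?_ (hμ _)
  have h2 : c + (1 - c) ≤ μ {ω | ∀ i, ω i ∈ G} + (1 - c) := by
    rwa [add_tsub_cancel_of_le hc1]
  exact (ENNReal.add_le_add_iff_right (ne_top_of_le_ne_top ENNReal.one_ne_top tsub_le_self)).1 h2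

/-- If a bounded function is subharmonic and increases by at least `c > 0` on average at every
visit of `F`, then almost surely `F` is visited only finitely often. -/
theorem chainPr_eventually_not_mem [Countable S] (k : S → S → ℝ≥0∞)
    (hk : ∀ a, ∑' b, k a b = 1) (s : S) (F : Set S) (β : S → ℝ≥0∞) (hβ : ∀ a, β a ≤ 1)
    (c : ℝ≥0∞) (hc : c ≠ 0)
    (hsub : ∀ a, β a + (if a ∈ F then c else 0) ≤ ∑' b, k a b * β b) :
    chainPr k s {ω | ∃ n, ∀ i, n < i → ω i ∉ F} = 1 := by
  let A : S → List S → Prop := fun a l => (a :: l).getLast (List.cons_ne_nil _ _) ∈ F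
  have hA : ∀ a b l, A a (b :: l) ↔ A b l := by
    intro a b l
    simp [A]
  have hzero : ∀ a, c * pathSum k 0 a (A a) = if a ∈ F then c else 0 := by
    intro a
    by_cases h : a ∈ F
    · have : A a [] := h
      simp [pathSum, this, h]
    · have : ¬ A a [] := h
      simp [pathSum, this, h]
  have hstep : ∀ i a, pathSum k (i + 1) a (A a) = ∑' b, k a b * pathSum k i b (A b) := by
    intro i a
    simp only [pathSum, hA]
  have hsum : ∀ n a, β a + ∑ i ∈ Finset.range n, c * pathSum k i a (A a) ≤ 1 := by
    intro n
    induction n with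
    | zero => intro a; simpa using hβ a
    | succ n ih =>
      intro a
      rw [Finset.sum_range_succ', add_comm _ (c * pathSum k 0 a (A a)), ← add_assoc]
      calc _ ≤ ∑' b, k a b * β b + ∑' b, k a b * ∑ i ∈ Finset.range n, c * pathSum k i b (A b) := by
            gcongr
            · rw [hzero]
              exact hsub a
            · simp only [hstep]
              rw [← Finset.mul_sum, ← Summable.tsum_finsetSum (fun _ _ => ENNReal.summable),
                ← ENNReal.tsum_mul_left]
              refine (tsum_congr fun b => ?_).le
              rw [← Finset.mul_sum, ← Finset.mul_sum, mul_left_comm]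
        _ = ∑' b, k a b * (β b + ∑ i ∈ Finset.range n, c * pathSum k i b (A b)) := by
            rw [← ENNReal.tsum_add]
            simp only [mul_add]
        _ ≤ ∑' b, k a b * 1 := by
            gcongr with b
            exact ih b
        _ = 1 := by simp [hk]
  have hfin : ∑' i, pathSum k i s (A s) ≠ ⊤ := by
    have : c * ∑' i, pathSum k i s (A s) ≤ 1 := by
      rw [← ENNReal.tsum_mul_left]
      exact ENNReal.tsum_le_of_sum_range_le fun n => le_trans le_add_self (hsum n s)
    intro h
    rw [h, ENNReal.mul_top hc] at this
    simp at this
  obtain ⟨μ, hμ1, -, hμ⟩ := exists_measure_le_chainPr k hk s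
  have hvis : ∀ i, chainPr k s {ω | ω i ∈ F} ≤ pathSum k i s (A s) := by
    intro i
    have := chainPr_prefix_le k i s (A s)
    refine le_trans ?_ this
    refine measure_mono ?_
    rintro ω ⟨h, h0⟩
    refine ⟨?_, h0⟩
    have e : (s :: prefixList i ω).getLast (List.cons_ne_nil _ _) = ω i := by
      cases i with
      | zero => simpa [prefixList] using (show ω 0 = s from h0).symm
      | succ i =>
        rw [List.getLast_eq_getElem]
        simp only [prefixList, List.length_cons, List.length_ofFn, Nat.add_sub_cancel,
          List.getElem_cons_succ, List.getElem_ofFn]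
    simpa [A, e] using h
  refine le_antisymm (chainPr_le_one k s _) ?_
  have hbad : μ {ω | ∃ n, ∀ i, n < i → ω i ∉ F}ᶜ = 0 := by
    have hlim : Filter.limsup (fun i => {ω : ℕ → S | ω i ∈ F}) Filter.atTop =
        {ω | ∃ n, ∀ i, n < i → ω i ∉ F}ᶜ := by
      ext ω
      simp only [Filter.limsup_eq_iInf_iSup_of_nat, Set.iInf_eq_iInter, Set.iSup_eq_iUnion,
        Set.mem_iInter, Set.mem_iUnion, Set.mem_ofPred_eq, Set.mem_compl_iff, not_exists, not_forall,
        not_not, exists_prop]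
      constructor
      · intro h n
        obtain ⟨i, hi, h'⟩ := h (n + 1)
        exact ⟨i, hi, h'⟩
      · intro h n
        obtain ⟨i, hi, h'⟩ := h n
        exact ⟨i, hi.le, h'⟩
    rw [← hlim]
    refine measure_limsup_atTop_eq_zero (ne_top_of_le_ne_top hfin ?_)
    exact ENNReal.tsum_le_tsum fun i => (hμ _).trans (hvis i)
  rw [← hμ1]
  refine le_trans ?_ (hμ _)
  rw [← Set.union_compl_self {ω : ℕ → S | ∃ n, ∀ i, n < i → ω i ∉ F}]
  refine (measure_union_le _ _).trans ?_
  rw [hbad, add_zero]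

end ChainLemmas

section MessageLoss

theorem countEmb_nil_right (v : List M) : countEmb v [] = 1 := by
  cases v <;> rfl

theorem countEmb_eq_zero_iff (v w : List M) : countEmb v w = 0 ↔ ¬ w.Sublist v := by
  induction v generalizing w with
  | nil => cases w <;> simp [countEmb]
  | cons a v ih =>
    cases w with
    | nil => simp [countEmb]
    | cons b w =>
      by_cases h : a = b
      · subst h
        simp only [countEmb, if_true, Nat.add_eq_zero_iff, ih, List.cons_sublist_cons]
        exact ⟨fun h => h.1, fun h => ⟨h, fun h' => h ((List.sublist_cons_self a w).trans h')⟩⟩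
      · simp only [countEmb, if_neg h, zero_add, ih]
        rw [not_iff_not]
        refine ⟨fun h' => h'.cons a, fun h' => ?_⟩
        cases h' with
        | cons _ h' => exact h'
        | cons_cons _ _ => exact absurd rfl h

/-- The sublists of `v`, without repetition. -/
def sublistFinset (v : List M) : Finset (List M) := v.sublists.toFinset

theorem mem_sublistFinset {v w : List M} : w ∈ sublistFinset v ↔ w.Sublist v := by
  simp [sublistFinset]

/-- Probability that a single channel content `v` becomes `w`. -/
noncomputable def wordLost (τ : ℝ) (v w : List M) : ℝ :=
  τ ^ (v.length - w.length) * (1 - τ) ^ w.length * countEmb v w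

theorem wordLost_eq_zero (τ : ℝ) {v w : List M} (h : ¬ w.Sublist v) : wordLost τ v w = 0 := by
  simp [wordLost, (countEmb_eq_zero_iff v w).2 h]

theorem wordLost_cons_nil (τ : ℝ) (a : M) (v : List M) :
    wordLost τ (a :: v) [] = τ * wordLost τ v [] := by
  simp [wordLost, countEmb_nil_right, pow_succ']

theorem wordLost_cons_cons (τ : ℝ) (a b : M) (v w : List M) :
    wordLost τ (a :: v) (b :: w) =
      (if a = b then (1 - τ) * wordLost τ v w else 0) + τ * wordLost τ v (b :: w) := by
  have h2 : τ ^ ((a :: v).length - (b :: w).length) * (1 - τ) ^ (b :: w).length *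
      countEmb v (b :: w) = τ * wordLost τ v (b :: w) := by
    by_cases h : (b :: w).Sublist v
    · have := h.length_le
      simp only [wordLost, List.length_cons] at this ⊢
      rw [show v.length + 1 - (w.length + 1) = (v.length - (w.length + 1)) + 1 by omega, pow_succ']
      ring
    · simp [wordLost_eq_zero τ h, (countEmb_eq_zero_iff v _).2 h]
  rw [← h2, wordLost, countEmb]
  split_ifs with h
  · simp only [wordLost, List.length_cons, Nat.add_sub_add_right, Nat.cast_add]
    ring
  · simp

/-- The generating function of the number of messages surviving in one channel. -/
theorem sum_wordLost_mul_pow (τ z : ℝ) (v : List M) (T : Finset (List M))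
    (hT : sublistFinset v ⊆ T) :
    ∑ w ∈ T, wordLost τ v w * z ^ w.length = (τ + (1 - τ) * z) ^ v.length := by
  have hred : ∀ (v : List M) (f : List M → ℝ) (T : Finset (List M)), sublistFinset v ⊆ T →
      ∑ w ∈ T, wordLost τ v w * f w = ∑ w ∈ sublistFinset v, wordLost τ v w * f w := by
    intro v f T hT
    refine (Finset.sum_subset hT fun w _ hw => ?_).symm
    rw [mem_sublistFinset] at hw
    simp [wordLost_eq_zero τ hw]
  rw [hred v _ T hT]
  clear hT T
  induction v with
  | nil =>
    have : sublistFinset ([] : List M) = {[]} := by simp [sublistFinset]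
    simp [this, wordLost, countEmb]
  | cons a v ih =>
    let T' := sublistFinset v
    have hrec : ∀ w, wordLost τ (a :: v) w = τ * wordLost τ v w +
        (1 - τ) * ∑ u ∈ T', if a :: u = w then wordLost τ v u else 0 := by
      intro w
      cases w with
      | nil => simp [wordLost_cons_nil]
      | cons b w =>
        rw [wordLost_cons_cons]
        by_cases hab : a = b
        · subst hab
          have : ∑ u ∈ T', (if a :: u = a :: w then wordLost τ v u else 0) = wordLost τ v w := by
            simp only [List.cons.injEq, true_and]
            rw [Finset.sum_ite_eq']
            split_ifs with h
            · rfl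
            · rw [mem_sublistFinset] at h
              rw [wordLost_eq_zero τ h]
          rw [this]
          simp [add_comm]
        · simp [hab]
    have hsub1 : T' ⊆ sublistFinset (a :: v) := by
      intro w hw
      rw [mem_sublistFinset] at hw ⊢
      exact hw.cons a
    calc ∑ w ∈ sublistFinset (a :: v), wordLost τ (a :: v) w * z ^ w.length
        = τ * ∑ w ∈ sublistFinset (a :: v), wordLost τ v w * z ^ w.length +
          (1 - τ) * ∑ u ∈ T', ∑ w ∈ sublistFinset (a :: v),
            (if a :: u = w then wordLost τ v u else 0) * z ^ w.length := by
          rw [Finset.sum_comm, Finset.mul_sum, Finset.mul_sum, ← Finset.sum_add_distrib]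
          refine Finset.sum_congr rfl fun w _ => ?_
          rw [hrec w, ← Finset.sum_mul]
          ring
      _ = τ * (τ + (1 - τ) * z) ^ v.length +
          (1 - τ) * ∑ u ∈ T', wordLost τ v u * z ^ (u.length + 1) := by
          rw [hred v _ _ hsub1, ih]
          congr 2
          refine Finset.sum_congr rfl fun u hu => ?_
          simp only [ite_mul, zero_mul]
          rw [Finset.sum_ite_eq, if_pos]
          · simp
          · rw [mem_sublistFinset] at hu ⊢
            exact hu.cons_cons a
      _ = _ := by
          simp only [pow_succ, ← mul_assoc]
          rw [← Finset.sum_mul, ih, List.length_cons, pow_succ]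
          ring

/-- Channel contents obtainable from `v` by message losses. -/
def subContents (v : Chans C M) : Finset (Chans C M) :=
  Fintype.piFinset fun c => sublistFinset (v c)

theorem mem_subContents {v w : Chans C M} : w ∈ subContents v ↔ ∀ c, (w c).Sublist (v c) := by
  simp [subContents, mem_sublistFinset]

/-- Real-valued version of `plost`. -/
noncomputable def realLost (τ : ℝ) (v w : Chans C M) : ℝ := ∏ c, wordLost τ (v c) (w c)

theorem realLost_eq_zero (τ : ℝ) {v w : Chans C M} (h : w ∉ subContents v) :
    realLost τ v w = 0 := by
  rw [mem_subContents, not_forall] at h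
  obtain ⟨c, hc⟩ := h
  exact Finset.prod_eq_zero (Finset.mem_univ c) (wordLost_eq_zero τ hc)

theorem plost_eq_ofReal (τ : ℝ) (v w : Chans C M) :
    plost τ v w = ENNReal.ofReal (realLost τ v w) := by
  rw [plost]
  congr 1
  by_cases h : w ∈ subContents v
  · rw [mem_subContents] at h
    have hsize : chansSize v - chansSize w = ∑ c, ((v c).length - (w c).length) := by
      simp only [chansSize]
      rw [Finset.sum_tsub_distrib _ fun c _ => (h c).length_le]
    rw [hsize, chansSize, realLost]
    simp only [wordLost, Finset.prod_mul_distrib, Finset.prod_pow_eq_pow_sum, Nat.cast_prod]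
  · rw [realLost_eq_zero τ h]
    rw [mem_subContents, not_forall] at h
    obtain ⟨c, hc⟩ := h
    rw [Finset.prod_eq_zero (Finset.mem_univ c) ((countEmb_eq_zero_iff _ _).2 hc)]
    simp

theorem realLost_nonneg {τ : ℝ} (h0 : 0 < τ) (h1 : τ < 1) (v w : Chans C M) :
    0 ≤ realLost τ v w :=
  Finset.prod_nonneg fun c _ => by
    have : 0 ≤ 1 - τ := by linarith
    unfold wordLost
    positivity

theorem plost_pos_iff {τ : ℝ} (h0 : 0 < τ) (h1 : τ < 1) (v w : Chans C M) :
    0 < plost τ v w ↔ ∀ c, (w c).Sublist (v c) := by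
  rw [plost_eq_ofReal, ENNReal.ofReal_pos, ← mem_subContents]
  refine ⟨fun h => ?_, fun h => ?_⟩
  · by_contra hw
    exact h.ne' (realLost_eq_zero τ hw)
  · rw [mem_subContents] at h
    refine Finset.prod_pos fun c _ => ?_
    have h2 : 0 < 1 - τ := by linarith
    have h3 : 0 < countEmb (v c) (w c) :=
      Nat.pos_of_ne_zero fun h' => (countEmb_eq_zero_iff _ _).1 h' (h c)
    unfold wordLost
    positivity

theorem realLost_eps (τ : ℝ) (v : Chans C M) : realLost τ v (eps C M) = τ ^ chansSize v := by
  simp [realLost, eps, wordLost, countEmb_nil_right, chansSize, Finset.prod_pow_eq_pow_sum]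

/-- The generating function of the number of surviving messages. -/
theorem sum_realLost_mul_pow (τ z : ℝ) (v : Chans C M) :
    ∑ w ∈ subContents v, realLost τ v w * z ^ chansSize w = (τ + (1 - τ) * z) ^ chansSize v := by
  have h : ∀ w : Chans C M, realLost τ v w * z ^ chansSize w =
      ∏ c, wordLost τ (v c) (w c) * z ^ (w c).length := by
    intro w
    rw [Finset.prod_mul_distrib, realLost, chansSize, Finset.prod_pow_eq_pow_sum]
  simp only [h, subContents]
  rw [← Finset.prod_univ_sum (t := fun c => sublistFinset (v c))
    (f := fun c u => wordLost τ (v c) u * z ^ u.length)]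
  simp only [sum_wordLost_mul_pow τ z _ _ subset_rfl, chansSize, Finset.prod_pow_eq_pow_sum]

theorem sum_realLost (τ : ℝ) (v : Chans C M) : ∑ w ∈ subContents v, realLost τ v w = 1 := by
  simpa using sum_realLost_mul_pow τ 1 v

theorem tsum_plost_mul {τ : ℝ} (h0 : 0 < τ) (h1 : τ < 1) (v : Chans C M) (g : Chans C M → ℝ)
    (hg : ∀ w, 0 ≤ g w) :
    ∑' w, plost τ v w * ENNReal.ofReal (g w) =
      ENNReal.ofReal (∑ w ∈ subContents v, realLost τ v w * g w) := by
  rw [tsum_eq_sum (s := subContents v)]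
  · rw [ENNReal.ofReal_sum_of_nonneg
      fun w _ => mul_nonneg (realLost_nonneg h0 h1 v w) (hg w)]
    refine Finset.sum_congr rfl fun w _ => ?_
    rw [plost_eq_ofReal, ENNReal.ofReal_mul (realLost_nonneg h0 h1 v w)]
  · intro w hw
    rw [plost_eq_ofReal, realLost_eq_zero τ hw]
    simp

theorem tsum_plost {τ : ℝ} (h0 : 0 < τ) (h1 : τ < 1) (v : Chans C M) :
    ∑' w, plost τ v w = 1 := by
  simpa [sum_realLost] using tsum_plost_mul h0 h1 v (fun _ => 1) fun _ => zero_le_one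

theorem chansSize_eq_zero_iff (w : Chans C M) : chansSize w = 0 ↔ w = eps C M := by
  simp only [chansSize, Finset.sum_eq_zero_iff, Finset.mem_univ, true_imp_iff,
    List.length_eq_zero_iff, funext_iff, eps]

theorem chansSize_update (w : Chans C M) (c : C) (u : List M) :
    chansSize (Function.update w c u) + (w c).length = chansSize w + u.length := by
  have h : ∀ x : Chans C M, chansSize x = (x c).length + ∑ d ∈ Finset.univ.erase c, (x d).length :=
    fun x => (Finset.add_sum_erase _ _ (Finset.mem_univ c)).symm
  rw [h, h w, Function.update_self]
  have : ∑ d ∈ Finset.univ.erase c, (Function.update w c u d).length =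
      ∑ d ∈ Finset.univ.erase c, (w d).length :=
    Finset.sum_congr rfl fun d hd => by rw [Function.update_of_ne (Finset.ne_of_mem_erase hd)]
  rw [this]
  omega

theorem chansSize_applyOp_le (op : LcsOp C M) (w : Chans C M) :
    chansSize (applyOp op w) ≤ chansSize w + 1 := by
  cases op with
  | send c m =>
    have := chansSize_update w c (w c ++ [m])
    simp only [applyOp, List.length_append, List.length_singleton] at this ⊢
    omega
  | recv c m =>
    have := chansSize_update w c (w c).tail
    simp only [applyOp, List.length_tail] at this ⊢
    omega
  | internal => simp [applyOp]

end MessageLoss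

section Kernel

theorem tsum_kernel_mul (U : Scheduler N) (a : List (Conf Q C M) × Conf Q C M)
    (f : List (Conf Q C M) × Conf Q C M → ℝ≥0∞) :
    ∑' b, U.kernel a b * f b =
      ∑' w, plost N.τ (applyOp (U.choose a.1 a.2).op a.2.2) w *
        f (a.1 ++ [a.2], ((U.choose a.1 a.2).dst, w)) := by
  have hinj : Function.Injective (fun w : Chans C M =>
      ((a.1 ++ [a.2], ((U.choose a.1 a.2).dst, w)) : List (Conf Q C M) × Conf Q C M)) := by
    intro w w' h
    simpa using h
  rw [← hinj.tsum_eq]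
  · refine tsum_congr fun w => ?_
    simp [Scheduler.kernel, NPLCS.stepProb, U.choose_mem, U.choose_enabled]
  · rintro ⟨h, p, w⟩ hb
    refine ⟨w, ?_⟩
    have hk : U.kernel a (h, p, w) ≠ 0 := left_ne_zero_of_mul hb
    simp only [Scheduler.kernel, NPLCS.stepProb, ne_eq, ite_eq_right_iff, not_forall] at hk
    obtain ⟨h1, h2, -⟩ := hk
    simp [h1, h2.2.2]

theorem tsum_kernel (U : Scheduler N) (a : List (Conf Q C M) × Conf Q C M) :
    ∑' b, U.kernel a b = 1 := by
  have := tsum_kernel_mul U a (fun _ => 1)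
  simpa [tsum_plost N.τ_pos N.τ_lt_one] using this

theorem stepProb_pos_of_stepVia {s t : Conf Q C M} {δ : LcsRule Q C M}
    (h : N.L.StepVia s δ t) : 0 < N.stepProb s δ t := by
  obtain ⟨h1, h2, h3, h4⟩ := h
  rw [NPLCS.stepProb, if_pos ⟨h1, h2, h3⟩]
  exact (plost_pos_iff N.τ_pos N.τ_lt_one _ _).2 h4

theorem stepProb_le_one (N : NPLCS Q C M) (s t : Conf Q C M) (δ : LcsRule Q C M) :
    N.stepProb s δ t ≤ 1 := by
  rw [NPLCS.stepProb]
  split_ifs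
  · rw [← tsum_plost N.τ_pos N.τ_lt_one (applyOp δ.op s.2)]
    exact ENNReal.le_tsum _
  · exact zero_le_one

theorem step_of_kernel_ne_zero (U : Scheduler N) {a b : List (Conf Q C M) × Conf Q C M}
    (h : U.kernel a b ≠ 0) : N.L.Step a.2 b.2 := by
  simp only [Scheduler.kernel, NPLCS.stepProb, ne_eq, ite_eq_right_iff, not_forall] at h
  obtain ⟨-, h2, h3⟩ := h
  exact ⟨_, h2.1, h2.2.1, h2.2.2,
    (plost_pos_iff N.τ_pos N.τ_lt_one _ _).1 (pos_iff_ne_zero.2 h3)⟩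

theorem pathSum_false {S : Type} (k : S → S → ℝ≥0∞) (n : ℕ) (s : S) :
    pathSum k n s (fun _ => False) = 0 := by
  induction n generalizing s with
  | zero => simp [pathSum]
  | succ n ih => simp [pathSum, ih]

theorem pathSum_forall_mem_succ {S : Type} (k : S → S → ℝ≥0∞) (n : ℕ) (s : S) (G : Set S) :
    pathSum k (n + 1) s (fun l => ∀ x ∈ l, x ∈ G) =
      ∑' b, k s b * if b ∈ G then pathSum k n b (fun l => ∀ x ∈ l, x ∈ G) else 0 := by
  rw [pathSum]
  refine tsum_congr fun b => ?_
  by_cases hb : b ∈ G <;> simp [hb, pathSum_false]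

end Kernel

section Escape

/-- Locations from which, with channels kept empty, `B` is left within `n` steps whatever the
chosen rules. -/
def escapeSet (L : LCS Q C M) (B : Set Q) : ℕ → Set Q
  | 0 => Bᶜ
  | n + 1 => escapeSet L B n ∪ {x | ∀ t, L.Step (x, eps C M) t → t.1 ∈ escapeSet L B n}

theorem escapeSet_mono (L : LCS Q C M) (B : Set Q) : Monotone (escapeSet L B) :=
  monotone_nat_of_le_succ fun _ => Set.subset_union_left

theorem exists_escapeSet_bound [Finite Q] (L : LCS Q C M) (B : Set Q) :
    ∃ n, (∀ x, x ∉ L.Safe B → x ∈ escapeSet L B n) ∧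
      ∀ m, escapeSet L B m ⊆ escapeSet L B n := by
  have h : ∀ x, ∃ n, ∀ m, x ∈ escapeSet L B m → x ∈ escapeSet L B n := by
    intro x
    by_cases hx : ∃ n, x ∈ escapeSet L B n
    · obtain ⟨n, hn⟩ := hx
      exact ⟨n, fun _ _ => hn⟩
    · exact ⟨0, fun m hm => absurd ⟨m, hm⟩ hx⟩
  choose n hn using h
  obtain ⟨K, hK⟩ := (Set.finite_range n).bddAbove
  have hsub : ∀ m, escapeSet L B m ⊆ escapeSet L B K := fun m x hx =>
    escapeSet_mono L B (hK ⟨x, rfl⟩) (hn x m hx)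
  refine ⟨K, fun x hx => ?_, hsub⟩
  by_contra hxK
  refine hx (Set.mem_sUnion.2 ⟨(escapeSet L B K)ᶜ, ⟨?_, ?_⟩, hxK⟩)
  · intro y hy
    by_contra hyB
    exact hy (hsub 0 hyB)
  · intro y hy
    by_contra hcon
    push Not at hcon
    refine hy (hsub (K + 1) (Or.inr fun t ht => ?_))
    by_contra h
    exact hcon t ht h

/-- A location weight which strictly increases by a fixed factor along every step from a location
of `B` outside `Safe(B)` with empty channels. -/
theorem exists_weight [Finite Q] (N : NPLCS Q C M) (B : Set Q) :
    ∃ (d₀ : ℝ) (d : Q → ℝ), 0 < d₀ ∧ (∀ x, d₀ ≤ d x) ∧ (∀ x, d x ≤ 1) ∧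
      ∀ x ∈ B, x ∉ N.L.Safe B → ∀ t, N.L.Step (x, eps C M) t → 2 * d x ≤ N.τ * d t.1 := by
  obtain ⟨K, hK, hsub⟩ := exists_escapeSet_bound N.L B
  have hτ := N.τ_pos
  have hτ1 := N.τ_lt_one
  have hex : ∀ x, ∃ n, x ∈ escapeSet N.L B n ∨ n = K := fun x => ⟨K, Or.inr rfl⟩
  have hanti : ∀ {m n : ℕ}, m ≤ n → (N.τ / 2) ^ n ≤ (N.τ / 2) ^ m := fun h =>
    pow_le_pow_of_le_one (by linarith) (by linarith) h
  refine ⟨(N.τ / 2) ^ K, fun x => (N.τ / 2) ^ Nat.find (hex x), by positivity, fun x => ?_,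
    fun x => pow_le_one₀ (by linarith) (by linarith), fun x hxB hxS t ht => ?_⟩
  · exact hanti (Nat.find_min' (hex x) (Or.inr rfl))
  · have hmem : x ∈ escapeSet N.L B (Nat.find (hex x)) := by
      rcases Nat.find_spec (hex x) with h | h
      · exact h
      · rw [h]
        exact hK x hxS
    rcases hfind : Nat.find (hex x) with _ | m
    · rw [hfind] at hmem
      exact absurd hxB hmem
    · have hnot : x ∉ escapeSet N.L B m := fun h =>
        Nat.find_min (hex x) (m := m) (by omega) (Or.inl h)
      rw [hfind] at hmem
      have ht' : t.1 ∈ escapeSet N.L B m := by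
        rcases hmem with h | h
        · exact absurd h hnot
        · exact h t ht
      have h1 := hanti (Nat.find_min' (hex t.1) (Or.inl ht'))
      change 2 * (N.τ / 2) ^ Nat.find (hex x) ≤ N.τ * (N.τ / 2) ^ Nat.find (hex t.1)
      rw [hfind]
      calc 2 * (N.τ / 2) ^ (m + 1) = N.τ * (N.τ / 2) ^ m := by ring
        _ ≤ _ := mul_le_mul_of_nonneg_left h1 N.τ_pos.le

theorem exists_drift_constants {τ d₀ : ℝ} (h0 : 0 < τ) (h1 : τ < 1) (hd : 0 < d₀) (hd1 : d₀ ≤ 1) :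
    ∃ ε ρ : ℝ, 0 < ε ∧ 0 < ρ ∧ ρ < 1 ∧
      (∀ k : ℕ, 1 + ε * (2 - τ) ^ (k + 1) - τ ^ (k + 1) * d₀ ≤ ρ * (1 + ε * 2 ^ k)) ∧
      ∀ d, d₀ ≤ d → d ≤ 1 → 1 + ε * (2 - τ) - 2 * d ≤ ρ * (1 + ε - d) := by
  obtain ⟨L, hL⟩ := exists_pow_lt_of_lt_one (x := 1 / 4) (y := (2 - τ) / 2) (by norm_num)
    (by linarith)
  have hy : 1 ≤ 2 - τ := by linarith
  have hL' : ∀ k, L ≤ k → (2 - τ) ^ (k + 1) ≤ 2 ^ k / 2 := by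
    intro k hk
    have h2 : ((2 - τ) / 2) ^ k ≤ 1 / 4 :=
      (pow_le_pow_of_le_one (by linarith) (by linarith) hk).trans hL.le
    rw [div_pow, div_le_iff₀ (by positivity)] at h2
    have h3 : (0 : ℝ) < 2 ^ k := by positivity
    rw [pow_succ]
    nlinarith [pow_pos (by linarith : (0 : ℝ) < 2 - τ) k]
  set D : ℝ := τ ^ (L + 1) * d₀ with hD
  have hDpos : 0 < D := by positivity
  have hDd : D ≤ d₀ := by
    have : τ ^ (L + 1) ≤ 1 := pow_le_one₀ h0.le h1.le
    nlinarith
  set Z : ℝ := (2 - τ) ^ (L + 1) with hZ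
  have hZ1 : 1 ≤ Z := one_le_pow₀ hy
  have hZy : 2 - τ ≤ Z := le_self_pow₀ hy (by omega)
  set ε : ℝ := D / (4 * Z) with hε
  have hεpos : 0 < ε := by positivity
  have hεZ : ε * Z = D / 4 := by
    rw [hε]; field_simp
  have hε1 : ε ≤ 1 := by
    have : ε * 1 ≤ ε * Z := by gcongr
    nlinarith
  set η : ℝ := ε / 4 with hη
  have hηD : η ≤ D / 4 := by
    have : ε * 1 ≤ ε * Z := by gcongr
    nlinarith
  refine ⟨ε, 1 - η, hεpos, by linarith, by linarith, fun k => ?_, fun d hd0 hd1' => ?_⟩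
  · have hk1 : (1 : ℝ) ≤ 2 ^ k := one_le_pow₀ (by norm_num)
    rcases le_or_gt L k with hk | hk
    · have h2 := hL' k hk
      have h3 : 0 ≤ τ ^ (k + 1) * d₀ := by positivity
      have h4 : ε * (2 - τ) ^ (k + 1) ≤ ε * (2 ^ k / 2) := by gcongr
      have h5 : η * (1 + ε * 2 ^ k) ≤ ε * 2 ^ k / 2 := by
        have h6 : ε * 2 ^ k ≤ 2 ^ k := by nlinarith
        have : η * (1 + ε * 2 ^ k) ≤ η * (2 ^ k + 2 ^ k) := by gcongr
        rw [hη] at this ⊢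
        linarith
      linarith
    · have h2 : (2 - τ) ^ (k + 1) ≤ Z := pow_le_pow_right₀ hy (by omega)
      have h3 : D ≤ τ ^ (k + 1) * d₀ := by
        rw [hD]
        gcongr ?_ * _
        exact pow_le_pow_of_le_one h0.le h1.le (by omega)
      have h4 : ε * (2 - τ) ^ (k + 1) ≤ ε * Z := by gcongr
      have h5 : 0 ≤ ε * 2 ^ k := by positivity
      have h6 : (1 - η) * 1 ≤ (1 - η) * (1 + ε * 2 ^ k) := by
        gcongr
        · linarith
        · linarith
      linarith
  · have h2 : ε * (2 - τ) ≤ ε * Z := by gcongr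
    nlinarith

end Escape

section NecessaryCondition

/-- Lyapunov function: large channel contents and large location weight count against it. -/
noncomputable def lyapunov (ε : ℝ) (d : Q → ℝ) (s : Conf Q C M) : ℝ :=
  1 + ε * 2 ^ chansSize s.2 - if s.2 = eps C M then d s.1 else 0

theorem lyapunov_nonneg {ε : ℝ} (hε : 0 ≤ ε) {d : Q → ℝ} (hd : ∀ x, d x ≤ 1) (s : Conf Q C M) :
    ε ≤ lyapunov ε d s := by
  unfold lyapunov
  have h1 : (1 : ℝ) ≤ 2 ^ chansSize s.2 := one_le_pow₀ (by norm_num)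
  have h2 : (if s.2 = eps C M then d s.1 else 0) ≤ 1 := by
    split_ifs
    · exact hd _
    · exact zero_le_one
  nlinarith

theorem sum_realLost_mul_lyapunov (τ ε : ℝ) (d : Q → ℝ) (p : Q) (v : Chans C M) :
    ∑ w ∈ subContents v, realLost τ v w * lyapunov ε d (p, w) =
      1 + ε * (2 - τ) ^ chansSize v - τ ^ chansSize v * d p := by
  have h1 := sum_realLost τ v
  have h2 := sum_realLost_mul_pow τ 2 v
  have h3 : ∑ w ∈ subContents v, realLost τ v w * (if w = eps C M then d p else 0) =
      τ ^ chansSize v * d p := by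
    rw [Finset.sum_eq_single (eps C M)]
    · rw [if_pos rfl, realLost_eps]
    · intro w _ hw
      rw [if_neg hw, mul_zero]
    · intro h
      rw [realLost_eq_zero τ h, zero_mul]
  calc ∑ w ∈ subContents v, realLost τ v w * lyapunov ε d (p, w)
      = ∑ w ∈ subContents v, realLost τ v w
        + ε * ∑ w ∈ subContents v, realLost τ v w * 2 ^ chansSize w
        - ∑ w ∈ subContents v, realLost τ v w * (if w = eps C M then d p else 0) := by
        rw [Finset.mul_sum, ← Finset.sum_add_distrib, ← Finset.sum_sub_distrib]
        refine Finset.sum_congr rfl fun w _ => ?_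
        simp only [lyapunov]
        ring
    _ = _ := by
        rw [h1, h2, h3]
        ring

theorem reach_of_always_pos [Fintype Q] [Fintype M] (q : Q) (B : Set Q) (U : Scheduler N)
    (hU : 0 < U.Pr (q, eps C M) (evAlways (inLoc B))) :
    ∃ t, N.L.ReachConstrained B (q, eps C M) t ∧ t.1 ∈ N.L.Safe B := by
  by_contra hcon
  push Not at hcon
  have hτ := N.τ_pos
  have hτ1 := N.τ_lt_one
  have hqB : q ∈ B := by
    by_contra hq
    have : {ω : ℕ → List (Conf Q C M) × Conf Q C M |
        (fun i => (ω i).2) ∈ evAlways (inLoc B)} ∩ {ω | ω 0 = ([], (q, eps C M))} = ∅ := by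
      ext ω
      simp only [Set.mem_inter_iff, Set.mem_ofPred_eq, Set.mem_empty_iff_false, iff_false, not_and]
      intro h h0
      have := h 0
      simp only [inLoc, h0] at this
      exact hq this
    simp [Scheduler.Pr, chainPr, this] at hU
  obtain ⟨d₀, d, hd₀, hdlow, hdle, hdstep⟩ := exists_weight N B
  obtain ⟨ε, ρ, hε, hρ, hρ1, hdrift, hdrift0⟩ :=
    exists_drift_constants hτ hτ1 hd₀ ((hdlow q).trans (hdle q))
  let G : Set (List (Conf Q C M) × Conf Q C M) := {b | b.2.1 ∈ B}
  have hstep : ∀ s : Conf Q C M, N.L.ReachConstrained B (q, eps C M) s → ∀ δ ∈ N.L.rules,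
      δ.EnabledIn s → 1 + ε * (2 - N.τ) ^ chansSize (applyOp δ.op s.2) -
        N.τ ^ chansSize (applyOp δ.op s.2) * d δ.dst ≤ ρ * lyapunov ε d s := by
    intro s hs δ hδ hen
    have hle := chansSize_applyOp_le δ.op s.2
    have h1 : (2 - N.τ) ^ chansSize (applyOp δ.op s.2) ≤ (2 - N.τ) ^ (chansSize s.2 + 1) :=
      pow_le_pow_right₀ (by linarith) hle
    have h2 : N.τ ^ (chansSize s.2 + 1) ≤ N.τ ^ chansSize (applyOp δ.op s.2) :=
      pow_le_pow_of_le_one hτ.le hτ1.le hle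
    have h3 : ε * (2 - N.τ) ^ chansSize (applyOp δ.op s.2) ≤
        ε * (2 - N.τ) ^ (chansSize s.2 + 1) := by gcongr
    have hdd := hdlow δ.dst
    by_cases he : s.2 = eps C M
    · have hz := (chansSize_eq_zero_iff s.2).2 he
      have h4 : N.τ ^ (chansSize s.2 + 1) * d δ.dst ≤
          N.τ ^ chansSize (applyOp δ.op s.2) * d δ.dst := by
        gcongr
        linarith
      have h5 : 2 * d s.1 ≤ N.τ * d δ.dst := by
        refine hdstep s.1 hs.2 (hcon s hs) (δ.dst, eps C M) ⟨δ, hδ, ?_, rfl, fun c => ?_⟩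
        · rw [← he]
          exact hen
        · exact List.nil_sublist _
      have h6 := hdrift0 (d s.1) (hdlow _) (hdle _)
      rw [hz] at h3 h4
      simp only [lyapunov, he, if_true, (chansSize_eq_zero_iff (eps C M)).2 rfl] 
      rw [he] at h3 h4
      simp only [zero_add, pow_one, pow_zero, mul_one] at h3 h4 ⊢
      linarith
    · have h4 : N.τ ^ (chansSize s.2 + 1) * d₀ ≤
          N.τ ^ chansSize (applyOp δ.op s.2) * d δ.dst := by
        gcongr
      have h5 := hdrift (chansSize s.2)
      simp only [lyapunov, he, if_false, sub_zero]
      linarith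
  have hbound : ∀ n a, N.L.ReachConstrained B (q, eps C M) a.2 →
      ENNReal.ofReal ε * pathSum U.kernel n a (fun l => ∀ x ∈ l, x ∈ G) ≤
        ENNReal.ofReal (ρ ^ n * lyapunov ε d a.2) := by
    intro n
    induction n with
    | zero =>
      intro a _
      simp only [pathSum, List.not_mem_nil, false_imp_iff, implies_true, if_true, mul_one,
        pow_zero, one_mul]
      exact ENNReal.ofReal_le_ofReal (lyapunov_nonneg hε.le hdle _)
    | succ n ih =>
      intro a ha
      set δ := U.choose a.1 a.2 with hδ
      have hly : ∀ s : Conf Q C M, 0 ≤ lyapunov ε d s := fun s =>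
        hε.le.trans (lyapunov_nonneg hε.le hdle s)
      rw [pathSum_forall_mem_succ, ← ENNReal.tsum_mul_left]
      calc _ ≤ ∑' b, U.kernel a b * ENNReal.ofReal (ρ ^ n * lyapunov ε d b.2) := by
            refine ENNReal.tsum_le_tsum fun b => ?_
            rw [mul_left_comm]
            by_cases hk : U.kernel a b = 0
            · simp [hk]
            · gcongr
              split_ifs with hb
              · exact ih b ⟨ha.1.tail ⟨step_of_kernel_ne_zero U hk, ha.2⟩, hb⟩
              · simp
        _ = ENNReal.ofReal (∑ w ∈ subContents (applyOp δ.op a.2.2),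
              realLost N.τ (applyOp δ.op a.2.2) w * (ρ ^ n * lyapunov ε d (δ.dst, w))) := by
            rw [tsum_kernel_mul U a (fun b => ENNReal.ofReal (ρ ^ n * lyapunov ε d b.2))]
            exact tsum_plost_mul hτ hτ1 _ (fun w => ρ ^ n * lyapunov ε d (δ.dst, w))
              fun w => mul_nonneg (by positivity) (hly _)
        _ ≤ _ := by
            refine ENNReal.ofReal_le_ofReal ?_
            have h := hstep a.2 ha δ (U.choose_mem _ _) (U.choose_enabled _ _)
            rw [← sum_realLost_mul_lyapunov] at h
            simp only [mul_left_comm _ (ρ ^ n)]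
            rw [← Finset.mul_sum, pow_succ, mul_assoc]
            gcongr
  have hle : ∀ n, ENNReal.ofReal ε * U.Pr (q, eps C M) (evAlways (inLoc B)) ≤
      ENNReal.ofReal (ρ ^ n * lyapunov ε d (q, eps C M)) := by
    intro n
    refine le_trans ?_ (hbound n ([], (q, eps C M)) ⟨Relation.ReflTransGen.refl, hqB⟩)
    gcongr
    refine le_trans (chainPr_le_of_subset _ _ ?_) (chainPr_prefix_le U.kernel n _ _)
    intro ω hω x hx
    simp only [prefixList, List.mem_ofFn] at hx
    obtain ⟨i, rfl⟩ := hx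
    exact hω (i + 1)
  have hlim : Filter.Tendsto (fun n : ℕ => ENNReal.ofReal (ρ ^ n * lyapunov ε d (q, eps C M)))
      Filter.atTop (nhds 0) := by
    have := (tendsto_pow_atTop_nhds_zero_of_lt_one hρ.le hρ1).mul_const
      (lyapunov ε d ((q, eps C M) : Conf Q C M))
    rw [zero_mul] at this
    simpa using ENNReal.tendsto_ofReal this
  have h0 := ge_of_tendsto' hlim hle
  have hpos : 0 < ENNReal.ofReal ε * U.Pr (q, eps C M) (evAlways (inLoc B)) :=
    ENNReal.mul_pos (ENNReal.ofReal_pos.2 hε).ne' hU.ne'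
  exact absurd h0 (not_le.2 hpos)

end NecessaryCondition

section SufficientCondition

theorem safe_subset (L : LCS Q C M) (B : Set Q) : L.Safe B ⊆ B := by
  rintro x ⟨X, hX, hx⟩
  exact hX.1 hx

/-- A choice of non-receive rules, one per location, that never leaves `Safe B`. -/
theorem exists_safe_rules (L : LCS Q C M) (B : Set Q) :
    ∃ g : Q → LcsRule Q C M, ∀ x, g x ∈ L.rules ∧ (g x).src = x ∧ ¬ (g x).op.IsRecv ∧
      (x ∈ L.Safe B → (g x).dst ∈ L.Safe B) := by
  have h : ∀ x, ∃ δ : LcsRule Q C M, δ ∈ L.rules ∧ δ.src = x ∧ ¬ δ.op.IsRecv ∧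
      (x ∈ L.Safe B → δ.dst ∈ L.Safe B) := by
    intro x
    by_cases hx : x ∈ L.Safe B
    · obtain ⟨X, hX, hxX⟩ := hx
      obtain ⟨t, ⟨δ, hδ, hen, hdst, -⟩, ht⟩ := hX.2 x hxX
      refine ⟨δ, hδ, hen.1, fun hr => ?_, fun _ => ⟨X, hX, hdst ▸ ht⟩⟩
      have hop := hen.2
      cases hδop : δ.op with
      | recv c m =>
        rw [hδop] at hop
        obtain ⟨v, hv⟩ := hop
        simp [eps] at hv
      | send c m => simp [hδop, LcsOp.IsRecv] at hr
      | internal => simp [hδop, LcsOp.IsRecv] at hr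
    · obtain ⟨δ, h1, h2, h3⟩ := L.noDeadlock x
      exact ⟨δ, h1, h2, h3, fun h => absurd h hx⟩
  choose g hg using h
  exact ⟨g, hg⟩

theorem enabledIn_of_not_isRecv {δ : LcsRule Q C M} {s : Conf Q C M} (h : δ.src = s.1)
    (hr : ¬ δ.op.IsRecv) : δ.EnabledIn s := by
  refine ⟨h, ?_⟩
  cases hδop : δ.op with
  | recv c m => simp [hδop, LcsOp.IsRecv] at hr
  | send c m => trivial
  | internal => trivial

/-- Finitely many configurations with prescribed rules suffice to reach `X` with positive
probability; `β` is a subharmonic lower bound on that probability. -/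
theorem exists_finite_plan (B X : Set Q) {s t : Conf Q C M} (hst : N.L.ReachWithin B s t)
    (ht : t.1 ∈ X) :
    ∃ (F : Finset (Conf Q C M)) (r : Conf Q C M → LcsRule Q C M) (β : Conf Q C M → ℝ≥0∞),
      (∀ c, β c ≤ 1) ∧ (∀ c, c.1 ∈ X → β c = 1) ∧ (∀ c, c.1 ∉ X → c ∉ F → β c = 0) ∧
      β s ≠ 0 ∧ ∀ c ∈ F, c.1 ∈ B ∧ β c ≠ 0 ∧ r c ∈ N.L.rules ∧ (r c).EnabledIn c ∧
        ∃ c', 2 * β c ≤ N.stepProb c (r c) c' * β c' := by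
  by_cases hne : Nonempty (LcsRule Q C M)
  swap
  · obtain ⟨δ, -⟩ := N.L.noDeadlock s.1
    exact absurd ⟨δ⟩ hne
  induction hst using Relation.ReflTransGen.head_induction_on with
  | refl =>
    refine ⟨∅, fun _ => hne.some, fun c => if c.1 ∈ X then 1 else 0, ?_, ?_, ?_, ?_, ?_⟩
    · intro c
      by_cases h : c.1 ∈ X <;> simp [h]
    · intro c h
      simp [h]
    · intro c h _
      simp [h]
    · simp [ht]
    · simp
  | @head a b hab _ ih =>
    obtain ⟨F, r, β, h1, h2, h3, h4, h5⟩ := ih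
    obtain ⟨⟨δ, hδ⟩, haB⟩ := hab
    by_cases haX : a.1 ∈ X
    · exact ⟨F, r, β, h1, h2, h3, by simp [h2 a haX], h5⟩
    by_cases haF : a ∈ F
    · exact ⟨F, r, β, h1, h2, h3, (h5 a haF).2.1, h5⟩
    have ha0 : β a = 0 := h3 a haX haF
    have hba : b ≠ a := by
      rintro rfl
      exact h4 ha0
    set v : ℝ≥0∞ := N.stepProb a δ b * β b / 2 with hv
    have hp := stepProb_pos_of_stepVia hδ
    have hv0 : v ≠ 0 := by
      simp [hv, hp.ne', h4]
    have hv1 : v ≤ 1 := by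
      calc v ≤ N.stepProb a δ b * β b := ENNReal.half_le_self
        _ ≤ 1 := mul_le_one' (stepProb_le_one N a b δ) (h1 b)
    have hmono : ∀ c, β c ≤ Function.update β a v c := by
      intro c
      by_cases hc : c = a
      · subst hc
        simp [ha0]
      · simp [hc]
    refine ⟨insert a F, Function.update r a δ, Function.update β a v, ?_, ?_, ?_, ?_, ?_⟩
    · intro c
      by_cases hc : c = a
      · subst hc
        simpa using hv1
      · simpa [hc] using h1 c
    · intro c hcX
      have hc : c ≠ a := by
        rintro rfl
        exact haX hcX
      simpa [hc] using h2 c hcX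
    · intro c hcX hcF
      rw [Finset.mem_insert, not_or] at hcF
      simpa [hcF.1] using h3 c hcX hcF.2
    · simpa using hv0
    · intro c hc
      by_cases hca : c = a
      · subst hca
        refine ⟨haB, by simpa using hv0, by simpa using hδ.1, by simpa using hδ.2.1, b, ?_⟩
        simp only [Function.update_self, Function.update_of_ne hba]
        rw [hv, ENNReal.mul_div_cancel (by simp) (by simp)]
      · obtain ⟨k1, k2, k3, k4, c', k5⟩ := h5 c ((Finset.mem_insert.1 hc).resolve_left hca)
        refine ⟨k1, by simpa [hca] using k2, by simpa [hca] using k3, by simpa [hca] using k4,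
          c', ?_⟩
        simp only [Function.update_of_ne hca]
        exact k5.trans (mul_le_mul_right (hmono c') _)

/-- If `Safe B` is reachable inside `B`, an almost blind memoryless scheduler ensures `□ B` with
positive probability. -/
theorem exists_almostBlind_of_reach [Fintype Q] [Fintype M] (q : Q) (B : Set Q)
    (h : ∃ t, N.L.ReachConstrained B (q, eps C M) t ∧ t.1 ∈ N.L.Safe B) :
    ∃ U : Scheduler N, U.AlmostBlind ∧ U.Memoryless ∧
      0 < U.Pr (q, eps C M) (evAlways (inLoc B)) := by
  obtain ⟨t, ⟨hst, -⟩, ht⟩ := h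
  obtain ⟨g, hg⟩ := exists_safe_rules N.L B
  obtain ⟨F, r, β, h1, h2, h3, h4, h5⟩ := exists_finite_plan B (N.L.Safe B) hst ht
  let V : Scheduler N :=
    { choose := fun _ c => g c.1
      choose_mem := fun _ c => (hg c.1).1
      choose_enabled := fun _ c => enabledIn_of_not_isRecv (hg c.1).2.1 (hg c.1).2.2.1 }
  let U : Scheduler N :=
    { choose := fun _ c => if c ∈ F ∧ c.1 ∉ N.L.Safe B then r c else g c.1
      choose_mem := fun _ c => by
        by_cases hc : c ∈ F ∧ c.1 ∉ N.L.Safe B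
        · simpa only [if_pos hc] using (h5 c hc.1).2.2.1
        · simpa only [if_neg hc] using (hg c.1).1
      choose_enabled := fun _ c => by
        by_cases hc : c ∈ F ∧ c.1 ∉ N.L.Safe B
        · simpa only [if_pos hc] using (h5 c hc.1).2.2.2.1
        · simpa only [if_neg hc] using
            enabledIn_of_not_isRecv (hg c.1).2.1 (hg c.1).2.2.1 }
  let F' : Set (List (Conf Q C M) × Conf Q C M) := {a | a.2 ∈ F ∧ a.2.1 ∉ N.L.Safe B}
  have hU1 : ∀ a, a ∈ F' → U.choose a.1 a.2 = r a.2 := fun a ha => if_pos ha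
  have hU2 : ∀ a, a ∉ F' → U.choose a.1 a.2 = g a.2.1 := fun a ha => if_neg ha
  have hc0 : F.inf β ≠ 0 := by
    rw [← pos_iff_ne_zero, Finset.lt_inf_iff (by simp)]
    exact fun c hc => pos_iff_ne_zero.2 (h5 c hc).2.1
  have hsub : ∀ a, β a.2 + (if a ∈ F' then F.inf β else 0) ≤ ∑' b, U.kernel a b * β b.2 := by
    intro a
    by_cases ha : a ∈ F'
    · obtain ⟨-, -, -, -, c', hc'⟩ := h5 a.2 ha.1
      rw [if_pos ha]
      calc β a.2 + F.inf β ≤ β a.2 + β a.2 := add_le_add le_rfl (Finset.inf_le ha.1)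
        _ = 2 * β a.2 := (two_mul _).symm
        _ ≤ U.kernel a (a.1 ++ [a.2], c') * β c' := by
          simpa only [Scheduler.kernel, if_true, hU1 a ha] using hc'
        _ ≤ _ := ENNReal.le_tsum (f := fun b => U.kernel a b * β b.2) (a.1 ++ [a.2], c')
    · rw [if_neg ha, add_zero]
      by_cases haX : a.2.1 ∈ N.L.Safe B
      · rw [h2 _ haX, tsum_kernel_mul U a (fun b => β b.2), hU2 a ha]
        simp only [h2 (_, _) ((hg a.2.1).2.2.2 haX), mul_one]
        exact (tsum_plost N.τ_pos N.τ_lt_one _).ge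
      · rw [h3 _ haX fun h => ha ⟨h, haX⟩]
        exact zero_le
  refine ⟨U, ⟨U, V, ?_, ?_⟩, fun _ _ _ => rfl, ?_⟩
  · intro h h' s s' _ hs
    change g s.1 = g s'.1
    rw [hs]
  · intro s
    refine le_antisymm (chainPr_le_one _ _ _) ?_
    rw [← chainPr_eventually_not_mem U.kernel (tsum_kernel U) ([], s) F' (fun a => β a.2)
      (fun a => h1 a.2) _ hc0 (fun a => by convert hsub a)]
    refine chainPr_le_of_subset _ _ ?_
    rintro ω ⟨n, hn⟩
    exact ⟨n, fun _ _ => rfl, fun i hi => hU2 (ω i) (hn i hi)⟩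
  · have hB : ∀ c : Conf Q C M, β c ≠ 0 → c.1 ∈ B := by
      intro c hc
      by_contra hcB
      exact hc (h3 c (fun h => hcB (safe_subset _ _ h)) fun h => hcB (h5 c h).1)
    let G : Set (List (Conf Q C M) × Conf Q C M) := {a | a.2.1 ∈ B}
    have hstay : ∀ n a, β a.2 ≤ pathSum U.kernel n a (fun l => ∀ x ∈ l, x ∈ G) := by
      intro n
      induction n with
      | zero => intro a; simpa [pathSum] using h1 a.2
      | succ n ih =>
        intro a
        rw [pathSum_forall_mem_succ]
        refine (le_self_add.trans (hsub a)).trans (ENNReal.tsum_le_tsum fun b => ?_)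
        by_cases hb : b ∈ G
        · rw [if_pos hb]
          exact mul_le_mul_right (ih b) _
        · have : β b.2 = 0 := by
            by_contra h0
            exact hb (hB _ h0)
          simp [this]
    exact (pos_iff_ne_zero.2 h4).trans_le
      (le_chainPr_always U.kernel (tsum_kernel U) ([], (q, eps C M)) G (hB _ h4) _
        fun n => hstay n _)

end SufficientCondition

/-- `□B` holds with positive probability under some scheduler iff it does
under some almost blind memoryless scheduler, iff `Safe(B)` is reachable from
`(q,ε)` by a path staying in `B`. -/
theorem statement8 {Q C M : Type} [Fintype Q] [Fintype C] [DecidableEq C]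
    [Fintype M] [DecidableEq M] (N : NPLCS Q C M) (q : Q) (B : Set Q) :
    ((∃ U : Scheduler N, 0 < U.Pr (q, eps C M) (evAlways (inLoc B))) ↔
      ∃ U : Scheduler N, U.AlmostBlind ∧ U.Memoryless ∧
        0 < U.Pr (q, eps C M) (evAlways (inLoc B)))
    ∧ ((∃ U : Scheduler N, 0 < U.Pr (q, eps C M) (evAlways (inLoc B))) ↔
      ∃ t, N.L.ReachConstrained B (q, eps C M) t ∧ t.1 ∈ N.L.Safe B) := by
  have h1 : (∃ U : Scheduler N, 0 < U.Pr (q, eps C M) (evAlways (inLoc B))) →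
      ∃ t, N.L.ReachConstrained B (q, eps C M) t ∧ t.1 ∈ N.L.Safe B :=
    fun ⟨U, hU⟩ => reach_of_always_pos q B U hU
  have h2 := exists_almostBlind_of_reach (N := N) q B
  exact ⟨⟨fun h => h2 (h1 h), fun ⟨U, _, _, hU⟩ => ⟨U, hU⟩⟩,
    h1, fun h => let ⟨U, _, _, hU⟩ := h2 h; ⟨U, hU⟩⟩

end NPLCSmodel
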